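/- arXiv:2207.03590 — 2 statements merged into one kernel-verified Lean document; each statement's English description precedes it below -/
import Mathlib

section
/- For a nonempty list of integers r₀, …, r_n, define the negative continued fraction [r₀, …, r_n] ∈ ℚ by [r_n] = r_n and [r_i, …, r_n] = r_i − 1/[r_{i+1}, …, r_n]. Suppose every r_i ≤ −2 (so that all intermediate values are < −1 and the expression is well defined), and write [r₀, …, r_n] = −p/q in lowest terms with p, q positive coprime integers (so p > q ≥ 1 and p ≥ 2). Then the reversed continued fraction satisfies [r_n, …, r₀] = −p/p′, where p′ is the unique integer with 0 < p′ < p and q·p′ ≡ 1 (mod p). -/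
/-- The negative continued fraction `[r₀, …, r_n] = r₀ − 1/(r₁ − 1/(⋯ − 1/r_n))` of a
list of integers, as a rational number.  (On the empty list it returns the junk value
`0`; since `1/0 = 0` in `ℚ`, this makes `ncf [r] = r`, and when all entries are `≤ −2`
every tail is `< −1`, so no genuine division by zero ever occurs.) -/
def ncf : List ℤ → ℚ
  | [] => 0
  | r :: t => (r : ℚ) - 1 / ncf t

/-- The product of the matrices `!![-r, -1; 1, 0]` over the entries `r` of a list. Its first
column holds the numerator and the denominator of `-ncf L`. -/
def ncfMatrix (L : List ℤ) : Matrix (Fin 2) (Fin 2) ℤ :=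
  (L.map fun r => !![-r, -1; 1, 0]).prod

theorem ncfMatrix_cons (r : ℤ) (t : List ℤ) :
    ncfMatrix (r :: t) = !![-r, -1; 1, 0] * ncfMatrix t := by
  simp [ncfMatrix]

theorem ncfMatrix_cons_zero_zero (r : ℤ) (t : List ℤ) :
    ncfMatrix (r :: t) 0 0 = -r * ncfMatrix t 0 0 - ncfMatrix t 1 0 := by
  simp [ncfMatrix_cons, Matrix.mul_apply, Fin.sum_univ_two, sub_eq_add_neg]

theorem ncfMatrix_cons_one_zero (r : ℤ) (t : List ℤ) :
    ncfMatrix (r :: t) 1 0 = ncfMatrix t 0 0 := by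
  simp [ncfMatrix_cons, Matrix.mul_apply, Fin.sum_univ_two]

theorem ncfMatrix_det (L : List ℤ) : (ncfMatrix L).det = 1 := by
  induction L with
  | nil => simp [ncfMatrix]
  | cons r t ih => rw [ncfMatrix_cons, Matrix.det_mul, ih]; simp

open Matrix in
theorem ncfMatrix_reverse (L : List ℤ) :
    ncfMatrix L.reverse = !![1, 0; 0, -1] * (ncfMatrix L)ᵀ * !![1, 0; 0, -1] := by
  induction L with
  | nil =>
    simp only [ncfMatrix, List.reverse_nil, List.map_nil, List.prod_nil, Matrix.transpose_one,
      Matrix.mul_one]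
    simp [Matrix.one_fin_two]
  | cons r t ih =>
    have happ : ncfMatrix (r :: t).reverse = ncfMatrix t.reverse * !![-r, -1; 1, 0] := by
      simp [ncfMatrix]
    have hD : (!![1, 0; 0, -1] : Matrix (Fin 2) (Fin 2) ℤ) * !![-r, -1; 1, 0]
        = !![-r, -1; 1, 0]ᵀ * !![1, 0; 0, -1] := by
      ext i j
      fin_cases i <;> fin_cases j <;> simp [Matrix.mul_apply, Fin.sum_univ_two]
    rw [happ, ih, ncfMatrix_cons, Matrix.transpose_mul, Matrix.mul_assoc, hD]
    simp only [Matrix.mul_assoc]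

theorem ncfMatrix_bounds {L : List ℤ} (hle : ∀ r ∈ L, r ≤ -2) :
    0 ≤ ncfMatrix L 1 0 ∧ ncfMatrix L 1 0 < ncfMatrix L 0 0 := by
  induction L with
  | nil => simp [ncfMatrix]
  | cons r t ih =>
    obtain ⟨h0, h1⟩ := ih fun x hx => hle x (List.mem_cons_of_mem _ hx)
    have hr := hle r List.mem_cons_self
    rw [ncfMatrix_cons_zero_zero, ncfMatrix_cons_one_zero]
    constructor <;> nlinarith

theorem ncf_eq_neg_div {L : List ℤ} (hle : ∀ r ∈ L, r ≤ -2) :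
    ncf L = -(ncfMatrix L 0 0 : ℚ) / ncfMatrix L 1 0 := by
  induction L with
  | nil => simp [ncf, ncfMatrix]
  | cons r t ih =>
    have ht : ∀ x ∈ t, x ≤ -2 := fun x hx => hle x (List.mem_cons_of_mem _ hx)
    obtain ⟨h0, h1⟩ := ncfMatrix_bounds ht
    have hP : (ncfMatrix t 0 0 : ℚ) ≠ 0 := by
      exact_mod_cast (h0.trans_lt h1).ne'
    rw [ncf, ih ht, ncfMatrix_cons_zero_zero, ncfMatrix_cons_one_zero, one_div_div]
    push_cast
    rw [div_neg, eq_div_iff hP, sub_neg_eq_add, add_mul, div_mul_cancel₀ _ hP]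
    ring

/-- If `[r₀, …, r_n] = −p/q` in lowest terms with `p > q ≥ 1` coprime and all
`r_i ≤ −2`, then the reversed continued fraction satisfies `[r_n, …, r₀] = −p/p′`,
where `p′` is the unique integer with `0 < p′ < p` and `q·p′ ≡ 1 (mod p)`. -/
theorem ncf_reverse (L : List ℤ) (hL : L ≠ []) (hle : ∀ r ∈ L, r ≤ -2)
    (p q p' : ℕ) (hq : 0 < q) (hqp : q < p) (hcop : Nat.Coprime p q)
    (hval : ncf L = -(p : ℚ) / q)
    (hp' : 0 < p') (hp'p : p' < p) (hmod : q * p' ≡ 1 [MOD p]) :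
    ncf L.reverse = -(p : ℚ) / p' := by
  have hrev : ∀ r ∈ L.reverse, r ≤ -2 := fun r hr => hle r (List.mem_reverse.mp hr)
  obtain ⟨hQ0, hQP⟩ := ncfMatrix_bounds hle
  obtain ⟨hS0, hSP⟩ := ncfMatrix_bounds hrev
  have hP_rev : ncfMatrix L.reverse 0 0 = ncfMatrix L 0 0 := by
    simp [ncfMatrix_reverse, Matrix.vecMul, dotProduct, Matrix.mul_apply, Fin.sum_univ_two]
  have hQ_rev : ncfMatrix L.reverse 1 0 = -ncfMatrix L 0 1 := by
    simp [ncfMatrix_reverse, Matrix.vecMul, dotProduct, Matrix.mul_apply, Fin.sum_univ_two]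
  have hdet := ncfMatrix_det L
  rw [Matrix.det_fin_two] at hdet
  rw [ncf_eq_neg_div hrev]
  rw [ncf_eq_neg_div hle] at hval
  rw [hP_rev] at hSP ⊢
  have hS : ncfMatrix L 0 1 = -ncfMatrix L.reverse 1 0 := by rw [hQ_rev, neg_neg]
  rw [hS] at hdet
  generalize ncfMatrix L.reverse 1 0 = S at *
  generalize ncfMatrix L 1 1 = R at *
  generalize ncfMatrix L 0 0 = P at *
  generalize ncfMatrix L 1 0 = Q at *
  have hqQ : (q : ℚ) ≠ 0 := by positivity
  have hQ_ne : (Q : ℚ) ≠ 0 := by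
    rintro h
    rw [h, div_zero, eq_comm, div_eq_zero_iff] at hval
    have : (p : ℚ) ≠ 0 := by exact_mod_cast (hq.trans hqp).ne'
    exact hval.elim (neg_ne_zero.mpr this) hqQ
  have hcross : P * q = p * Q := by
    rw [div_eq_div_iff hQ_ne hqQ] at hval
    have : (P : ℚ) * q = p * Q := by linarith
    exact_mod_cast this
  have hcopPQ : IsCoprime P Q := ⟨R, S, by linarith⟩
  have hcoppq : IsCoprime (p : ℤ) q := Nat.isCoprime_iff_coprime.mpr hcop
  have hPp : P = p := Int.dvd_antisymm (hQ0.trans hQP.le) (Int.natCast_nonneg p)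
    (hcopPQ.dvd_of_dvd_mul_right ⟨q, hcross.symm⟩) (hcoppq.dvd_of_dvd_mul_right ⟨Q, hcross⟩)
  subst hPp
  have hp_ne : (p : ℤ) ≠ 0 := (hQ0.trans_lt hQP).ne'
  have hQq : Q = q := (mul_left_cancel₀ hp_ne hcross).symm
  subst hQq
  have hmod' : (p : ℤ) ∣ 1 - q * p' := by
    have h := (Nat.modEq_iff_dvd.mp hmod)
    push_cast at h
    exact h
  have hdvd : (p : ℤ) ∣ S - p' := by
    refine hcoppq.dvd_of_dvd_mul_left ?_
    have h : (q : ℤ) * (S - p') = (1 - q * p') - p * R := by linarith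
    rw [h]
    exact dvd_sub hmod' (dvd_mul_right _ _)
  have hSp' : S = p' := by
    have h := Int.eq_zero_of_abs_lt_dvd hdvd (abs_lt.mpr ⟨by omega, by omega⟩)
    omega
  rw [hSp']
  simp
end

section
/- Let λ₀ : ℝ → ℝ be a C² function and define g₀ : ℝ³ → ℝ³ by g₀(x, y, z) = (x, y·λ₀(x) + z·λ₀′(x), z·λ₀(x)). Let ω be the 1-form on ℝ³ given at a point (x, y, z) on a tangent vector (a, b, c) by ω_{(x,y,z)}(a, b, c) = c − y·a (this is the contact form dz − y dx). Then for every point p = (x, y, z) ∈ ℝ³ and every tangent vector (a, b, c) ∈ ℝ³, ω_{g₀(p)}(Dg₀(p)(a, b, c)) = λ₀(x)·ω_p(a, b, c), where Dg₀(p) is the total derivative of g₀ at p; that is, g₀*(dz − y dx) = λ₀(x)·(dz − y dx). -/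
/-- The map `g₀(x, y, z) = (x, y·λ₀(x) + z·λ₀′(x), z·λ₀(x))`. -/
noncomputable def gZero (lam0 : ℝ → ℝ) : ℝ × ℝ × ℝ → ℝ × ℝ × ℝ :=
  fun p => (p.1, p.2.1 * lam0 p.1 + p.2.2 * deriv lam0 p.1, p.2.2 * lam0 p.1)

/-- The contact form `ω = dz − y dx` on `ℝ³`: at the point `(x, y, z)` on the tangent
vector `(a, b, c)` it is `c − y·a`. -/
def omegaForm (p v : ℝ × ℝ × ℝ) : ℝ := v.2.2 - p.2.1 * v.1

/-- `g₀*(dz − y dx) = λ₀(x)·(dz − y dx)`: for a `C²` function `λ₀`, the map `g₀`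
pulls back the standard contact form to `λ₀(x)` times itself. -/
theorem gZero_pullback (lam0 : ℝ → ℝ) (hlam0 : ContDiff ℝ 2 lam0)
    (p v : ℝ × ℝ × ℝ) :
    omegaForm (gZero lam0 p) (fderiv ℝ (gZero lam0) p v) =
      lam0 p.1 * omegaForm p v := by
  have h_lam : HasDerivAt lam0 (deriv lam0 p.1) p.1 :=
    (hlam0.differentiable (by norm_num) p.1).hasDerivAt
  have h_deriv : HasDerivAt (deriv lam0) (deriv (deriv lam0) p.1) p.1 :=
    ((ContDiff.differentiable_deriv_two hlam0) p.1).hasDerivAt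
  have hx : HasFDerivAt (fun q : ℝ × ℝ × ℝ => q.1) _ p :=
    hasFDerivAt_fst (𝕜 := ℝ)
  have hyz : HasFDerivAt (fun q : ℝ × ℝ × ℝ => q.2) _ p :=
    hasFDerivAt_snd (𝕜 := ℝ)
  have h_lam_x := h_lam.comp_hasFDerivAt p hx
  have h_deriv_x := h_deriv.comp_hasFDerivAt p hx
  have h_gZero : HasFDerivAt (gZero lam0) _ p :=
    hx.prodMk (((hyz.fst.mul h_lam_x).add (hyz.snd.mul h_deriv_x)).prodMk
      (hyz.snd.mul h_lam_x))
  rw [h_gZero.fderiv]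
  simp [omegaForm, gZero]
  ring
end
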